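/- arXiv:1410.4585 — 3 statements merged into one kernel-verified Lean document; each statement's English description precedes it below -/
import Mathlib

section
/- Let H be a bipartite graph on h vertices with hcf(H) ≠ 1. Then for every positive integer n with 2n divisible by h, there exists a balanced bipartite graph G on 2n vertices with minimum degree δ(G) = ⌈n/2⌉ − 1 that contains no H-factor. -/
open Finset

attribute [local instance] Classical.propDecidable

namespace BipTiling

variable {α β V : Type*}

/-- A proper 2-coloring of the graph `H`. -/
def Proper2Coloring (H : SimpleGraph α) (c : α → Bool) : Prop :=
  ∀ ⦃a b : α⦄, H.Adj a b → c a ≠ c b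

/-- `H` is bipartite, i.e. it admits a proper 2-coloring. -/
def IsBip (H : SimpleGraph α) : Prop :=
  ∃ c : α → Bool, Proper2Coloring H c

/-- The size of the color class of color `i` under the 2-coloring `c`. -/
noncomputable def colorCard [Fintype α] (c : α → Bool) (i : Bool) : ℕ :=
  (Finset.univ.filter fun v => c v = i).card

/-- `σ(H)`: the smallest size of a color class over all proper 2-colorings of `H`. -/
noncomputable def sigmaBip [Fintype α] (H : SimpleGraph α) : ℕ :=
  sInf {k | ∃ c : α → Bool, Proper2Coloring H c ∧
    k = min (colorCard c true) (colorCard c false)}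

/-- The finset of connected components of `H`. -/
noncomputable def comps [Fintype α] (H : SimpleGraph α) : Finset H.ConnectedComponent :=
  Finset.univ.image H.connectedComponentMk

/-- `c_i`: the number of vertices of the connected component `K`. -/
noncomputable def compCard [Fintype α] (H : SimpleGraph α) (K : H.ConnectedComponent) : ℕ :=
  (Finset.univ.filter fun v => H.connectedComponentMk v = K).card

/-- `d_i = |W_i| - |U_i|`: the (absolute) difference of the sizes of the two color classes
of the component `K`, computed with respect to a proper 2-coloring `c` of `H`.
(For a proper 2-coloring this is independent of the choice of `c`, since the 2-coloring of a
connected bipartite graph is unique up to swapping the colors.) -/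
noncomputable def compDiff [Fintype α] (H : SimpleGraph α) (c : α → Bool)
    (K : H.ConnectedComponent) : ℕ :=
  (((Finset.univ.filter fun v => H.connectedComponentMk v = K ∧ c v = true).card : ℤ) -
    ((Finset.univ.filter fun v => H.connectedComponentMk v = K ∧ c v = false).card : ℤ)).natAbs

/-- `hcf_c(H) = gcd(c_1, …, c_k)`. -/
noncomputable def hcfC [Fintype α] (H : SimpleGraph α) : ℕ :=
  (comps H).gcd (compCard H)

/-- `hcf_{χ,c}(H) = gcd(d_1, …, d_k)`, with respect to a proper 2-coloring `c`. -/
noncomputable def hcfChiC [Fintype α] (H : SimpleGraph α) (c : α → Bool) : ℕ :=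
  (comps H).gcd (compDiff H c)

/-- `x_2 - x_1` for the 2-coloring `c`, where `x_1 ≤ x_2` are the sizes of its color classes. -/
noncomputable def colorDiff [Fintype α] (c : α → Bool) : ℕ :=
  ((colorCard c true : ℤ) - (colorCard c false : ℤ)).natAbs

/-- `hcf_χ(H)`: the gcd of the set `D(H)` of all differences `x_2 - x_1` of color class sizes
over all proper 2-colorings of `H` (`0` represents `∞`, i.e. `D(H) = {0}`). -/
noncomputable def hcfChi [Fintype α] (H : SimpleGraph α) : ℕ :=
  (Finset.univ.filter fun c : α → Bool => Proper2Coloring H c).gcd colorDiff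

/-- `hcf(H) = 1` for a bipartite graph `H`: `hcf_c(H) = 1` and `hcf_χ(H) ≤ 2`
(in particular `hcf_χ(H)` is finite, i.e. nonzero in our encoding). -/
def HcfOne [Fintype α] (H : SimpleGraph α) : Prop :=
  hcfC H = 1 ∧ 0 < hcfChi H ∧ hcfChi H ≤ 2

/-- `f` is a copy of `H` inside `G` (an injective graph homomorphism). -/
def IsCopy (H : SimpleGraph α) (G : SimpleGraph β) (f : α → β) : Prop :=
  Function.Injective f ∧ ∀ ⦃a b : α⦄, H.Adj a b → G.Adj (f a) (f b)

/-- `s` is an `H`-tiling of `G`: a finite collection of pairwise vertex-disjoint copies of `H`. -/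
def IsHTiling (H : SimpleGraph α) (G : SimpleGraph β) (s : Finset (α → β)) : Prop :=
  (∀ f ∈ s, IsCopy H G f) ∧
    ∀ f ∈ s, ∀ g ∈ s, f ≠ g → ∀ a b : α, f a ≠ g b

/-- The set of vertices covered by the tiling `s`. -/
noncomputable def coveredSet [Fintype α] [Fintype β] (s : Finset (α → β)) : Finset β :=
  s.biUnion fun f => Finset.univ.image f

/-- `G` has a perfect `H`-tiling (`H`-factor). -/
def HasHFactor [Fintype α] [Fintype β] (H : SimpleGraph α) (G : SimpleGraph β) : Prop :=
  ∃ s : Finset (α → β), IsHTiling H G s ∧ coveredSet s = Finset.univ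

/-- `G` has an `H`-tiling covering all but at most `t` vertices. -/
def HasHTilingMissingAtMost [Fintype α] [Fintype β] (H : SimpleGraph α) (G : SimpleGraph β)
    (t : ℕ) : Prop :=
  ∃ s : Finset (α → β), IsHTiling H G s ∧ (Finset.univ \ coveredSet s).card ≤ t

/-- `G` is a bipartite graph with partition sets `X` and `Y`, written `G[X,Y]`. -/
structure BipartiteWith [Fintype V] (G : SimpleGraph V) (X Y : Finset V) : Prop where
  disj : Disjoint X Y
  cover : X ∪ Y = Finset.univ
  cross : ∀ ⦃a b : V⦄, G.Adj a b → (a ∈ X ∧ b ∈ Y) ∨ (a ∈ Y ∧ b ∈ X)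

/-- `e(A,B)`: the number of edges of `G` between `A` and `B`. -/
noncomputable def eAB (G : SimpleGraph V) (A B : Finset V) : ℕ :=
  ((A ×ˢ B).filter fun p => G.Adj p.1 p.2).card

/-- The density `d(A,B) = e(A,B)/(|A||B|)`. -/
noncomputable def dens (G : SimpleGraph V) (A B : Finset V) : ℝ :=
  (eAB G A B : ℝ) / ((A.card : ℝ) * (B.card : ℝ))

/-- `|Γ(x) ∩ B|`: the number of neighbors of `x` in `B`. -/
noncomputable def degIn (G : SimpleGraph V) (x : V) (B : Finset V) : ℕ :=
  (B.filter fun y => G.Adj x y).card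

/-- The pair `(X,Y)` is `ε`-regular in `G`. -/
def EpsRegularPair (G : SimpleGraph V) (X Y : Finset V) (ε : ℝ) : Prop :=
  ∀ A ⊆ X, ∀ B ⊆ Y, ε * X.card < A.card → ε * Y.card < B.card →
    |dens G A B - dens G X Y| < ε

/-- The pair `(X,Y)` is `(ε,δ)`-super-regular in `G`. -/
def SuperRegularPair (G : SimpleGraph V) (X Y : Finset V) (ε δ : ℝ) : Prop :=
  EpsRegularPair G X Y ε ∧
    (∀ x ∈ X, δ * Y.card < (degIn G x Y : ℝ)) ∧
    (∀ y ∈ Y, δ * X.card < (degIn G y X : ℝ))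

/-- `G[X,Y]` has an almost `(ε,d,p,q,N)`-cover. -/
def HasAlmostCover [Fintype V] (G : SimpleGraph V) (X Y : Finset V) (ε d : ℝ) (p q N : ℕ) :
    Prop :=
  ∃ (X₀ Y₀ : Finset V) (k : ℕ) (P Q : Fin k → Finset V),
    X₀ ⊆ X ∧ Y₀ ⊆ Y ∧
    (X₀.card : ℝ) ≤ ε * X.card ∧ (Y₀.card : ℝ) ≤ ε * Y.card ∧
    ((X₀ ∪ Y₀) ∪ Finset.univ.biUnion fun i => P i ∪ Q i) = Finset.univ ∧
    (∀ i, Disjoint (X₀ ∪ Y₀) (P i ∪ Q i)) ∧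
    (∀ i j, i ≠ j → Disjoint (P i ∪ Q i) (P j ∪ Q j)) ∧
    (∀ i, Disjoint (P i) (Q i)) ∧
    (∀ i, SuperRegularPair G (P i) (Q i) ε d) ∧
    (∀ i, (P i ⊆ X ∧ Q i ⊆ Y) ∨ (P i ⊆ Y ∧ Q i ⊆ X)) ∧
    (∀ i, q * (P i).card = p * (Q i).card ∧ N * p ≤ (P i).card)

/-- `G[X,Y]` (with `|X| = |Y| = n`) is in the extremal case with parameter `a`:
there are `A ⊆ X`, `B ⊆ Y` with `|A| = |B| = ⌊wn/h⌋` and `d(A,B) ≤ a`. -/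
def ExtremalWith [Fintype V] (G : SimpleGraph V) (X Y : Finset V) (w h : ℕ) (a : ℝ) : Prop :=
  ∃ A ⊆ X, ∃ B ⊆ Y, A.card = w * X.card / h ∧ B.card = w * X.card / h ∧ dens G A B ≤ a

/-- The number of vertices satisfying `P` is the sum, over the copies in a perfect tiling, of the
number of vertices of the copy satisfying `P`. -/
lemma card_filter_eq_sum_of_tiling [Fintype α] [Fintype β] {H : SimpleGraph α} {G : SimpleGraph β}
    {s : Finset (α → β)} (hs : IsHTiling H G s) (hcov : coveredSet s = univ) (P : β → Prop)
    [DecidablePred P] :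
    (univ.filter P).card = ∑ f ∈ s, (univ.filter fun v => P (f v)).card := by
  have hP : univ.filter P = s.biUnion fun f => (univ.filter fun v => P (f v)).image f := by
    ext x
    have hx : x ∈ coveredSet s := hcov ▸ mem_univ x
    simp only [coveredSet, mem_biUnion, mem_image, mem_univ, true_and, mem_filter] at hx ⊢
    constructor
    · obtain ⟨f, hf, v, rfl⟩ := hx
      exact fun h => ⟨f, hf, v, h, rfl⟩
    · rintro ⟨f, -, v, h, rfl⟩
      exact h
  rw [hP, card_biUnion]
  · exact sum_congr rfl fun f hf => card_image_of_injective _ (hs.1 f hf).1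
  · intro f hf g hg hfg
    refine Finset.disjoint_left.2 ?_
    intro x hx hx'
    obtain ⟨v, -, rfl⟩ := mem_image.1 hx
    obtain ⟨w, -, hw⟩ := mem_image.1 hx'
    exact hs.2 f hf g hg hfg v w hw.symm

/-- `hcf_c(H)` divides the size of every union of connected components of `H`. -/
lemma hcfC_dvd_card_filter [Fintype α] (H : SimpleGraph α) (Q : α → Prop)
    (hQ : ∀ a b, H.Adj a b → (Q a ↔ Q b)) : hcfC H ∣ (univ.filter Q).card := by
  have hreach : ∀ a b, H.Reachable a b → (Q a ↔ Q b) := by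
    rintro a b ⟨w⟩
    induction w with
    | nil => rfl
    | cons hadj _ ih => exact (hQ _ _ hadj).trans ih
  rw [card_eq_sum_card_fiberwise (f := H.connectedComponentMk) (t := comps H)
    fun v _ => mem_coe.2 (mem_image_of_mem _ (mem_univ v))]
  refine dvd_sum fun K hK => ?_
  obtain ⟨r, -, rfl⟩ := mem_image.1 hK
  have hmem : ∀ v, H.connectedComponentMk v = H.connectedComponentMk r → (Q v ↔ Q r) :=
    fun v hv => hreach v r (SimpleGraph.ConnectedComponent.exact hv)
  by_cases hr : Q r
  · refine (gcd_dvd hK).trans (dvd_of_eq ?_)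
    rw [compCard, filter_filter]
    congr 1
    ext v
    simp only [mem_filter, mem_univ, true_and]
    exact ⟨fun hv => ⟨(hmem v hv).2 hr, hv⟩, fun hv => hv.2⟩
  · rw [filter_filter, filter_false_of_mem, card_empty]
    · exact dvd_zero _
    · exact fun v _ hv => hr ((hmem v hv.2).1 hv.1)

/-- If `G` has an `H`-factor then `hcf_c(H)` divides the size of every union of connected
components of `G`. -/
lemma HasHFactor.hcfC_dvd [Fintype α] [Fintype β] {H : SimpleGraph α} {G : SimpleGraph β}
    (hHG : HasHFactor H G) (P : β → Prop) (hP : ∀ a b, G.Adj a b → (P a ↔ P b)) :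
    hcfC H ∣ (univ.filter P).card := by
  obtain ⟨s, hs, hcov⟩ := hHG
  rw [card_filter_eq_sum_of_tiling hs hcov]
  exact dvd_sum fun f hf => hcfC_dvd_card_filter H _ fun a b hab => hP _ _ ((hs.1 f hf).2 hab)

/-- If `G` has an `H`-factor then `hcf_χ(H)` divides the difference of the color class sizes of
every proper 2-coloring of `G`. -/
lemma HasHFactor.hcfChi_dvd [Fintype α] [Fintype β] {H : SimpleGraph α} {G : SimpleGraph β}
    (hHG : HasHFactor H G) (c : β → Bool) (hc : Proper2Coloring G c) :
    (hcfChi H : ℤ) ∣ (colorCard c true : ℤ) - colorCard c false := by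
  obtain ⟨s, hs, hcov⟩ := hHG
  rw [colorCard, colorCard, card_filter_eq_sum_of_tiling hs hcov,
    card_filter_eq_sum_of_tiling hs hcov, Nat.cast_sum, Nat.cast_sum, ← sum_sub_distrib]
  refine dvd_sum fun f hf => ?_
  have hcf : Proper2Coloring H (fun v => c (f v)) := fun a b hab => hc ((hs.1 f hf).2 hab)
  have hdvd : hcfChi H ∣ colorDiff fun v => c (f v) :=
    gcd_dvd (mem_filter.2 ⟨mem_univ _, hcf⟩)
  exact Int.natCast_dvd.2 hdvd

/-- Membership in the union of the first `a` left vertices and the first `b` right vertices. -/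
def initialPart (n a b : ℕ) : Fin n ⊕ Fin n → Prop :=
  Sum.elim (fun i => i.val < a) (fun j => j.val < b)

/-- The disjoint union of the complete bipartite graphs `K_{a,b}` and `K_{n-a,n-b}`. -/
def twoBicliques (n a b : ℕ) : SimpleGraph (Fin n ⊕ Fin n) where
  Adj u v := u.isLeft ≠ v.isLeft ∧ (initialPart n a b u ↔ initialPart n a b v)
  symm := ⟨fun _ _ h => ⟨h.1.symm, h.2.symm⟩⟩
  loopless := ⟨fun _ h => h.1 rfl⟩

lemma card_filter_sum {γ δ : Type*} [Fintype γ] [Fintype δ] (P : γ ⊕ δ → Prop)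
    [DecidablePred P] :
    (univ.filter P).card =
      (univ.filter fun i => P (.inl i)).card + (univ.filter fun j => P (.inr j)).card := by
  simp only [card_filter, Fintype.sum_sum_type]

lemma card_filter_fin_lt {n a : ℕ} (ha : a ≤ n) :
    (univ.filter fun i : Fin n => i.val < a).card = a := by
  rw [Fin.card_filter_val_lt, min_eq_right ha]

lemma card_filter_fin_not_lt {n a : ℕ} (ha : a ≤ n) :
    (univ.filter fun i : Fin n => ¬ i.val < a).card = n - a := by
  have h := card_filter_add_card_filter_not (s := (univ : Finset (Fin n))) fun i => i.val < a
  rw [card_filter_fin_lt ha, card_univ, Fintype.card_fin] at h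
  omega

lemma card_initialPart {n a b : ℕ} (ha : a ≤ n) (hb : b ≤ n) :
    (univ.filter (initialPart n a b)).card = a + b := by
  rw [card_filter_sum]
  convert congrArg₂ (· + ·) (card_filter_fin_lt ha) (card_filter_fin_lt hb) using 1
  simp only [initialPart, Sum.elim_inl, Sum.elim_inr]
  congr

lemma degree_twoBicliques (n a b : ℕ) (v : Fin n ⊕ Fin n) :
    (twoBicliques n a b).degree v = (univ.filter ((twoBicliques n a b).Adj v)).card := by
  rw [← SimpleGraph.card_neighborFinset_eq_degree]
  congr 1
  ext w
  simp

lemma degree_twoBicliques_inl {n a b : ℕ} (hb : b ≤ n) (i : Fin n) :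
    (twoBicliques n a b).degree (.inl i) = if i.val < a then b else n - b := by
  rw [degree_twoBicliques, card_filter_sum]
  split_ifs with hi
  · simpa [twoBicliques, initialPart, hi] using card_filter_fin_lt hb
  · simpa [twoBicliques, initialPart, hi] using card_filter_fin_not_lt hb

lemma degree_twoBicliques_inr {n a b : ℕ} (ha : a ≤ n) (j : Fin n) :
    (twoBicliques n a b).degree (.inr j) = if j.val < b then a else n - a := by
  rw [degree_twoBicliques, card_filter_sum]
  split_ifs with hj
  · simpa [twoBicliques, initialPart, hj] using card_filter_fin_lt ha
  · simpa [twoBicliques, initialPart, hj] using card_filter_fin_not_lt ha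

/-- An `H`-factor of `K_{a,b} ∪ K_{n-a,n-b}` forces `hcf_c(H) ∣ a + b`. -/
lemma hcfC_dvd_of_twoBicliques [Fintype α] {H : SimpleGraph α} {n a b : ℕ} (ha : a ≤ n)
    (hb : b ≤ n) (hHG : HasHFactor H (twoBicliques n a b)) : hcfC H ∣ a + b := by
  rw [← card_initialPart ha hb]
  exact hHG.hcfC_dvd _ fun _ _ h => h.2

/-- An `H`-factor of `K_{a,b} ∪ K_{n-a,n-b}` forces `hcf_χ(H) ∣ 2(a - b)`. -/
lemma hcfChi_dvd_of_twoBicliques [Fintype α] {H : SimpleGraph α} {n a b : ℕ} (ha : a ≤ n)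
    (hb : b ≤ n) (hHG : HasHFactor H (twoBicliques n a b)) :
    (hcfChi H : ℤ) ∣ 2 * ((a : ℤ) - b) := by
  have hdvd := hHG.hcfChi_dvd
    (Sum.elim (fun i => decide (i.val < a)) fun j => decide (¬ j.val < b)) (by
      rintro (i | i) (j | j) ⟨hside, hpart⟩ <;>
        simp only [initialPart, Sum.elim_inl, Sum.elim_inr] at hpart <;> simp_all <;> omega)
  have htrue : colorCard (Sum.elim (fun i : Fin n => decide (i.val < a))
      fun j : Fin n => decide (¬ j.val < b)) true = a + (n - b) := by
    rw [colorCard, card_filter_sum]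
    simpa only [Sum.elim_inl, Sum.elim_inr, decide_eq_true_eq] using
      congrArg₂ _ (card_filter_fin_lt ha) (card_filter_fin_not_lt hb)
  have hfalse : colorCard (Sum.elim (fun i : Fin n => decide (i.val < a))
      fun j : Fin n => decide (¬ j.val < b)) false = (n - a) + b := by
    rw [colorCard, card_filter_sum]
    simpa only [Sum.elim_inl, Sum.elim_inr, decide_eq_false_iff_not, not_not] using
      congrArg₂ _ (card_filter_fin_not_lt ha) (card_filter_fin_lt hb)
  rw [htrue, hfalse] at hdvd
  convert hdvd using 1
  omega

/-- Proposition 1.3, part 1. If `H` is a bipartite graph on `h` vertices with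
`hcf(H) ≠ 1`, then for every positive `n` with `h ∣ 2n` there is a balanced bipartite graph `G`
on `2n` vertices with minimum degree exactly `⌈n/2⌉ - 1` and no `H`-factor. -/
theorem statement_0 {α : Type*} [Fintype α] (H : SimpleGraph α) (h : ℕ)
    (hh : Fintype.card α = h) (hbip : IsBip H) (hhcf : ¬ HcfOne H)
    (n : ℕ) (hn : 0 < n) (hdvd : h ∣ 2 * n) :
    ∃ G : SimpleGraph (Fin n ⊕ Fin n),
      (∀ a b : Fin n ⊕ Fin n, G.Adj a b → a.isLeft ≠ b.isLeft) ∧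
      (∀ v, (n + 1) / 2 - 1 ≤ G.degree v) ∧
      (∃ v, G.degree v = (n + 1) / 2 - 1) ∧
      ¬ HasHFactor H G := by
  set k := (n + 1) / 2 - 1 with hk
  have main : ∀ b, k ≤ b → b ≤ k + 1 → 0 < b → ¬ HasHFactor H (twoBicliques n k b) →
      ∃ G : SimpleGraph (Fin n ⊕ Fin n),
        (∀ a b : Fin n ⊕ Fin n, G.Adj a b → a.isLeft ≠ b.isLeft) ∧
        (∀ v, k ≤ G.degree v) ∧ (∃ v, G.degree v = k) ∧ ¬ HasHFactor H G := by
    intro b hkb hbk hb hno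
    refine ⟨twoBicliques n k b, fun _ _ h => h.1, ?_, ⟨.inr ⟨0, hn⟩, ?_⟩, hno⟩
    · rintro (i | j)
      · rw [degree_twoBicliques_inl (by omega)]
        split_ifs <;> omega
      · rw [degree_twoBicliques_inr (by omega)]
        split_ifs <;> omega
    · rw [degree_twoBicliques_inr (by omega), if_pos hb]
  by_cases hodd : HasHFactor H (twoBicliques n k (k + 1))
  · have hC := hcfC_dvd_of_twoBicliques (by omega) (by omega) hodd
    have hchi := hcfChi_dvd_of_twoBicliques (by omega) (by omega) hodd
    have hchi2 : hcfChi H ∣ 2 := by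
      have h2 : 2 * ((k : ℤ) - (k + 1 : ℕ)) = -2 := by push_cast; ring
      rw [h2, dvd_neg] at hchi
      exact_mod_cast hchi
    have hC1 : hcfC H ≠ 1 := fun h1 =>
      hhcf ⟨h1, Nat.pos_of_dvd_of_pos hchi2 two_pos, Nat.le_of_dvd two_pos hchi2⟩
    have hnot : ¬ hcfC H ∣ k + k := fun h2 => hC1 (Nat.dvd_one.1 ((Nat.dvd_add_right h2).1 hC))
    have hkpos : 0 < k := Nat.pos_of_ne_zero fun h0 => hnot (by simp [h0])
    exact main k le_rfl (by omega) hkpos fun heven =>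
      hnot (hcfC_dvd_of_twoBicliques (by omega) (by omega) heven)
  · exact main (k + 1) (by omega) le_rfl (by omega) hodd

end BipTiling
end

section
/- Let H be a bipartite graph with hcf_c(H) = 1. Then hcf_χ(H) ≤ 2 if and only if hcf_{χ,c}(H) = 1. -/
open Finset

attribute [local instance] Classical.propDecidable

namespace BipTiling

variable {α β V : Type*}

/-- The sign `±1` attached to a color. -/
def colorSign (b : Bool) : ℤ := if b then 1 else -1

lemma colorSign_not (b : Bool) : colorSign (!b) = -colorSign b := by
  cases b <;> rfl

lemma card_sub_card_eq_sum_colorSign (s : Finset α) (c : α → Bool) :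
    ((s.filter fun v => c v = true).card : ℤ) - ((s.filter fun v => c v = false).card : ℤ) =
      ∑ v ∈ s, colorSign (c v) := by
  rw [Finset.card_filter, Finset.card_filter]
  push_cast
  rw [← Finset.sum_sub_distrib]
  refine Finset.sum_congr rfl fun v _ => ?_
  cases h : c v <;> simp [colorSign]

lemma colorDiff_eq [Fintype α] (c : α → Bool) :
    colorDiff c = (∑ v, colorSign (c v)).natAbs := by
  rw [← card_sub_card_eq_sum_colorSign]
  rfl

lemma compDiff_eq [Fintype α] (H : SimpleGraph α) (c : α → Bool) (K : H.ConnectedComponent) :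
    compDiff H c K =
      (∑ v ∈ Finset.univ.filter fun v => H.connectedComponentMk v = K,
        colorSign (c v)).natAbs := by
  rw [← card_sub_card_eq_sum_colorSign, Finset.filter_filter, Finset.filter_filter]
  rfl

/-- Two proper 2-colorings agree, or disagree, simultaneously at any two reachable vertices. -/
lemma Proper2Coloring.xor_eq_of_reachable {H : SimpleGraph α} {c c' : α → Bool}
    (hc : Proper2Coloring H c) (hc' : Proper2Coloring H c') {a b : α} (h : H.Reachable a b) :
    (c a ^^ c' a) = (c b ^^ c' b) := by
  obtain ⟨p⟩ := h
  induction p with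
  | nil => rfl
  | cons hadj _ ih =>
    rw [← ih]
    have h₁ := hc hadj
    have h₂ := hc' hadj
    revert h₁ h₂
    generalize c _ = x
    generalize c _ = y
    generalize c' _ = z
    generalize c' _ = w
    revert x y z w
    decide

lemma Proper2Coloring.compDiff_eq {H : SimpleGraph α} [Fintype α] {c c' : α → Bool}
    (hc : Proper2Coloring H c) (hc' : Proper2Coloring H c') (K : H.ConnectedComponent) :
    compDiff H c K = compDiff H c' K := by
  rw [BipTiling.compDiff_eq, BipTiling.compDiff_eq]
  induction K using SimpleGraph.ConnectedComponent.ind with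
  | h a =>
    have key : ∀ v ∈ Finset.univ.filter
        (fun v => H.connectedComponentMk v = H.connectedComponentMk a),
        (c a ^^ c' a) = (c v ^^ c' v) := fun v hv =>
      hc.xor_eq_of_reachable hc'
        (SimpleGraph.ConnectedComponent.exact (Finset.mem_filter.mp hv).2).symm
    cases h : (c a ^^ c' a) with
    | false =>
      congr 1
      refine Finset.sum_congr rfl fun v hv => ?_
      have := key v hv
      rw [h] at this
      rw [show c v = c' v by simpa using this.symm]
    | true =>
      rw [← Int.natAbs_neg, ← Finset.sum_neg_distrib]
      congr 1
      refine Finset.sum_congr rfl fun v hv => ?_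
      have := key v hv
      rw [h] at this
      rw [← colorSign_not, show (!c v) = c' v by
        revert this; cases c v <;> cases c' v <;> simp]

lemma mem_comps [Fintype α] {H : SimpleGraph α} (K : H.ConnectedComponent) : K ∈ comps H := by
  induction K using SimpleGraph.ConnectedComponent.ind with
  | h a => exact Finset.mem_image_of_mem _ (Finset.mem_univ a)

/-- `hcf_{χ,c}(H)` divides `hcf_χ(H)`. -/
lemma hcfChiC_dvd_hcfChi [Fintype α] {H : SimpleGraph α} {c : α → Bool}
    (hc : Proper2Coloring H c) : hcfChiC H c ∣ hcfChi H := by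
  refine Finset.dvd_gcd fun c' hc' => ?_
  have hc' : Proper2Coloring H c' := (Finset.mem_filter.mp hc').2
  rw [colorDiff_eq, ← Int.natCast_dvd, ← Finset.sum_fiberwise_of_maps_to
    (t := comps H) (g := H.connectedComponentMk) (fun v _ => mem_comps _)]
  refine Finset.dvd_sum fun K hK => ?_
  rw [Int.natCast_dvd, ← compDiff_eq, ← hc.compDiff_eq hc']
  exact Finset.gcd_dvd hK

/-- Swapping the colors on a single component keeps a 2-coloring proper. -/
lemma Proper2Coloring.swap_component {H : SimpleGraph α} {c : α → Bool}
    (hc : Proper2Coloring H c) (K : H.ConnectedComponent) :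
    Proper2Coloring H fun v => if H.connectedComponentMk v = K then !c v else c v := by
  intro a b hab
  have h := hc hab
  simp only [SimpleGraph.ConnectedComponent.sound hab.reachable]
  split_ifs <;> simpa using h

/-- `hcf_χ(H)` divides `2 hcf_{χ,c}(H)`. -/
lemma hcfChi_dvd_two_mul_hcfChiC [Fintype α] {H : SimpleGraph α} {c : α → Bool}
    (hc : Proper2Coloring H c) : hcfChi H ∣ 2 * hcfChiC H c := by
  have hdvd : ∀ c', Proper2Coloring H c' → (hcfChi H : ℤ) ∣ ∑ v, colorSign (c' v) := by
    intro c' hc'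
    rw [Int.natCast_dvd, ← colorDiff_eq]
    exact Finset.gcd_dvd (by simpa using hc')
  rw [hcfChiC, ← normalize_eq 2, ← Finset.gcd_mul_left]
  refine Finset.dvd_gcd fun K _ => ?_
  have h := dvd_sub (hdvd c hc) (hdvd _ (hc.swap_component K))
  have hsum : ∑ v, colorSign (c v) -
      ∑ v, colorSign (if H.connectedComponentMk v = K then !c v else c v) =
      2 * ∑ v ∈ Finset.univ.filter fun v => H.connectedComponentMk v = K,
        colorSign (c v) := by
    rw [← Finset.sum_sub_distrib, Finset.sum_filter, Finset.mul_sum]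
    refine Finset.sum_congr rfl fun v _ => ?_
    split_ifs
    · rw [colorSign_not]; ring
    · ring
  rw [hsum, Int.natCast_dvd, Int.natAbs_mul, ← compDiff_eq] at h
  exact h

/-- The number of vertices of a component has the parity of its color class difference. -/
lemma two_dvd_compCard_of_two_dvd_compDiff [Fintype α] {H : SimpleGraph α} {c : α → Bool}
    {K : H.ConnectedComponent} (h : 2 ∣ compDiff H c K) : 2 ∣ compCard H K := by
  have hcard := Finset.card_filter_add_card_filter_not
    (s := Finset.univ.filter fun v => H.connectedComponentMk v = K) (fun v => c v = true)
  simp only [Finset.filter_filter, Bool.not_eq_true] at hcard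
  unfold compDiff at h
  unfold compCard
  omega

/-- Lemma 2.1, part 3. If `H` is bipartite (with proper 2-coloring `c`) and
`hcf_c(H) = 1`, then `hcf_χ(H) ≤ 2` (finite) iff `hcf_{χ,c}(H) = 1`. -/
theorem statement_7 {α : Type*} [Fintype α] (H : SimpleGraph α) (c : α → Bool)
    (hc : Proper2Coloring H c) (h1 : hcfC H = 1) :
    (0 < hcfChi H ∧ hcfChi H ≤ 2) ↔ hcfChiC H c = 1 := by
  constructor
  · rintro ⟨hpos, hle⟩
    have hdvd := hcfChiC_dvd_hcfChi hc
    have hle' : hcfChiC H c ≤ 2 := (Nat.le_of_dvd hpos hdvd).trans hle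
    have hpos' : 0 < hcfChiC H c := Nat.pos_of_dvd_of_pos hdvd hpos
    have hne : hcfChiC H c ≠ 2 := fun h2 => by
      have h : 2 ∣ hcfC H := Finset.dvd_gcd fun K hK =>
        two_dvd_compCard_of_two_dvd_compDiff (h2 ▸ Finset.gcd_dvd hK : 2 ∣ compDiff H c K)
      omega
    omega
  · intro h
    have hdvd := hcfChi_dvd_two_mul_hcfChiC hc
    rw [h, mul_one] at hdvd
    exact ⟨Nat.pos_of_dvd_of_pos hdvd two_pos, Nat.le_of_dvd two_pos hdvd⟩

end BipTiling
end

section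
/- Let H be a bipartite graph on h vertices with hcf_{χ,c}(H) = 1, σ(H) = u, w = h − u and u < w, and let β = β(H). Let m, q, t, r be nonnegative integers with t = q(w − u) + r and 0 ≤ r < w − u. If m ≥ rβ + q and q ≥ rβ, then the complete bipartite graph K_{mu+t, mw−t} contains an H-factor. -/
open Finset

attribute [local instance] Classical.propDecidable

namespace BipTiling

variable {α β V : Type*}

/-- The number of vertices of color `i` in the connected component `K`. -/
noncomputable def compColorCard {α : Type*} [Fintype α] (H : SimpleGraph α) (c : α → Bool)
    (K : H.ConnectedComponent) (i : Bool) : ℕ :=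
  (Finset.univ.filter fun v => H.connectedComponentMk v = K ∧ c v = i).card

/-- The coloring obtained from `c` by swapping the colors on the components selected by `s`. -/
def swapColors {α : Type*} (H : SimpleGraph α) (c : α → Bool)
    (s : H.ConnectedComponent → Bool) : α → Bool :=
  fun v => xor (c v) (s (H.connectedComponentMk v))

lemma Proper2Coloring.swapColors {α : Type*} {H : SimpleGraph α} {c : α → Bool}
    (hc : Proper2Coloring H c) (s : H.ConnectedComponent → Bool) :
    Proper2Coloring H (swapColors H c s) := by
  intro a b hab
  have hne := hc hab
  have hK : H.connectedComponentMk a = H.connectedComponentMk b :=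
    SimpleGraph.ConnectedComponent.sound hab.reachable
  simpa [BipTiling.swapColors, hK] using hne

lemma Proper2Coloring.exists_eq_swapColors {α : Type*} {H : SimpleGraph α} {c c' : α → Bool}
    (hc : Proper2Coloring H c) (hc' : Proper2Coloring H c') :
    ∃ s : H.ConnectedComponent → Bool, c' = BipTiling.swapColors H c s := by
  have hadj : ∀ a b, H.Adj a b → xor (c a) (c' a) = xor (c b) (c' b) := by
    intro a b hab
    have h₁ := hc hab
    have h₂ := hc' hab
    revert h₁ h₂
    cases c a <;> cases c b <;> cases c' a <;> cases c' b <;> simp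
  have hwalk : ∀ a b, ∀ _ : H.Walk a b, xor (c a) (c' a) = xor (c b) (c' b) := by
    intro a b p
    induction p with
    | nil => rfl
    | cons hab _ ih => exact (hadj _ _ hab).trans ih
  refine ⟨SimpleGraph.ConnectedComponent.lift (fun v => xor (c v) (c' v))
    fun a b p _ => hwalk a b p, ?_⟩
  funext v
  simp [BipTiling.swapColors]

lemma colorCard_eq_sum_compColorCard {α : Type*} [Fintype α] (H : SimpleGraph α)
    (c : α → Bool) (i : Bool) :
    colorCard c i = ∑ K ∈ comps H, compColorCard H c K i := by
  rw [colorCard, Finset.card_eq_sum_card_fiberwise (f := H.connectedComponentMk) (t := comps H)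
    (fun v _ => Finset.mem_image_of_mem _ (Finset.mem_univ v))]
  refine Finset.sum_congr rfl fun K _ => ?_
  rw [compColorCard, Finset.filter_filter]
  congr 1
  ext v
  simp [and_comm]

lemma compColorCard_swapColors {α : Type*} [Fintype α] (H : SimpleGraph α) (c : α → Bool)
    (s : H.ConnectedComponent → Bool) (K : H.ConnectedComponent) (i : Bool) :
    compColorCard H (swapColors H c s) K i = compColorCard H c K (xor i (s K)) := by
  unfold compColorCard
  congr 1
  ext v
  rw [Finset.mem_filter, Finset.mem_filter]
  refine and_congr_right fun _ => and_congr_right fun hv => ?_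
  rw [swapColors, hv]
  cases c v <;> cases s K <;> cases i <;> simp

/-- A proper coloring whose color `true` is the minority color on every component attains
`σ(H)`. -/
lemma sigmaBip_eq_colorCard {α : Type*} [Fintype α] {H : SimpleGraph α} {c : α → Bool}
    (hc : Proper2Coloring H c)
    (hle : ∀ K, compColorCard H c K true ≤ compColorCard H c K false) :
    sigmaBip H = colorCard c true := by
  have hmin : ∀ c', Proper2Coloring H c' → ∀ i, colorCard c true ≤ colorCard c' i := by
    intro c' hc' i
    obtain ⟨s, rfl⟩ := hc.exists_eq_swapColors hc'
    rw [colorCard_eq_sum_compColorCard H, colorCard_eq_sum_compColorCard H]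
    refine Finset.sum_le_sum fun K _ => ?_
    rw [compColorCard_swapColors]
    cases xor i (s K)
    · exact hle K
    · exact le_rfl
  apply le_antisymm
  · exact Nat.sInf_le ⟨c, hc, (min_eq_left (hmin c hc false)).symm⟩
  · refine le_csInf ⟨_, c, hc, rfl⟩ ?_
    rintro k ⟨c', hc', rfl⟩
    exact le_min (hmin c' hc' true) (hmin c' hc' false)

lemma colorCard_true_add_false {α : Type*} [Fintype α] (c : α → Bool) :
    colorCard c true + colorCard c false = Fintype.card α := by
  have h := Finset.card_filter_add_card_filter_not (s := (Finset.univ : Finset α))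
    (fun v => c v = true)
  simpa [colorCard] using h

/-- Every proper coloring can be normalized so that `true` is the minority color on every
component. -/
lemma Proper2Coloring.exists_minority {α : Type*} [Fintype α] {H : SimpleGraph α}
    {c : α → Bool} (hc : Proper2Coloring H c) :
    ∃ c', Proper2Coloring H c' ∧ ∀ K,
      (compColorCard H c' K false : ℤ) = compColorCard H c' K true + compDiff H c K := by
  refine ⟨BipTiling.swapColors H c
    fun K => decide (compColorCard H c K false < compColorCard H c K true),
    hc.swapColors _, fun K => ?_⟩
  rw [compColorCard_swapColors, compColorCard_swapColors]
  have hd : compDiff H c K =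
    ((compColorCard H c K true : ℤ) - (compColorCard H c K false : ℤ)).natAbs := rfl
  by_cases hlt : compColorCard H c K false < compColorCard H c K true
  · simp only [hlt, decide_true, Bool.xor_true, Bool.not_false, Bool.not_true]
    omega
  · simp only [hlt, decide_false, Bool.xor_false]
    omega

lemma mem_coveredSet {α β : Type*} [Fintype α] [Fintype β] {s : Finset (α → β)} {z : β} :
    z ∈ coveredSet s ↔ ∃ f ∈ s, ∃ v, f v = z := by
  simp [coveredSet]

/-- A family of proper colorings of `H` with the right total color class sizes gives an
`H`-factor of a complete bipartite graph. -/
lemma hasHFactor_of_colorings {α ι : Type*} [Fintype α] [Fintype ι] {H : SimpleGraph α}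
    {x y : ℕ} (χ : ι → α → Bool) (hχ : ∀ j, Proper2Coloring H (χ j))
    (hx : ∑ j, colorCard (χ j) true = x) (hy : ∑ j, colorCard (χ j) false = y) :
    HasHFactor H (completeBipartiteGraph (Fin x) (Fin y)) := by
  have hcard : ∀ i, Fintype.card {p : ι × α // χ p.1 p.2 = i} = ∑ j, colorCard (χ j) i := by
    intro i
    simp only [Fintype.card_subtype, colorCard, Finset.card_filter, Fintype.sum_prod_type]
  let e₁ : {p : ι × α // χ p.1 p.2 = true} ≃ Fin x :=
    Fintype.equivFinOfCardEq ((hcard true).trans hx)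
  let e₂ : {p : ι × α // ¬ χ p.1 p.2 = true} ≃ Fin y :=
    (Equiv.subtypeEquivRight fun p => by simp).trans
      (Fintype.equivFinOfCardEq ((hcard false).trans hy))
  let e : ι × α ≃ Fin x ⊕ Fin y :=
    (Equiv.sumCompl fun p : ι × α => χ p.1 p.2 = true).symm.trans (Equiv.sumCongr e₁ e₂)
  have he : ∀ p, (e p).isLeft = χ p.1 p.2 := by
    intro p
    by_cases hp : χ p.1 p.2 = true
    · simp [e, hp, Equiv.sumCompl_symm_apply_of_pos]
    · simp [e, hp, Equiv.sumCompl_symm_apply_of_neg]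
  refine ⟨Finset.univ.image fun j v => e (j, v), ⟨?_, ?_⟩, ?_⟩
  · intro f hf
    obtain ⟨j, -, rfl⟩ := Finset.mem_image.1 hf
    refine ⟨fun a b hab => (Prod.ext_iff.1 (e.injective hab)).2, fun a b hab => ?_⟩
    have h₁ := he (j, a)
    have h₂ := he (j, b)
    have hne := hχ j hab
    dsimp only at h₁ h₂ ⊢
    rw [← h₁, ← h₂] at hne
    revert hne
    cases e (j, a) <;> cases e (j, b) <;> simp
  · intro f hf g hg hfg a b hab
    obtain ⟨j, -, rfl⟩ := Finset.mem_image.1 hf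
    obtain ⟨k, -, rfl⟩ := Finset.mem_image.1 hg
    obtain rfl : j = k := (Prod.ext_iff.1 (e.injective hab)).1
    exact hfg rfl
  · refine Finset.eq_univ_of_forall fun z => ?_
    exact mem_coveredSet.2 ⟨_, Finset.mem_image_of_mem _ (Finset.mem_univ (e.symm z).1),
      (e.symm z).2, e.apply_symm_apply z⟩

/-- If color `true` is replaced by color `false` on `K` in exactly the first `n K` of `m` copies,
the total number of vertices of color `true` increases by `n K` times the difference of the
color classes of `K`. -/
lemma sum_colorCard_swapColors {α : Type*} [Fintype α] (H : SimpleGraph α) (c : α → Bool)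
    (m : ℕ) (n : H.ConnectedComponent → ℕ) (hn : ∀ K ∈ comps H, n K ≤ m) :
    ((∑ j : Fin m, colorCard (swapColors H c fun K => decide (j.val < n K)) true : ℕ) : ℤ) =
      m * colorCard c true +
        ∑ K ∈ comps H, n K * ((compColorCard H c K false : ℤ) - compColorCard H c K true) := by
  simp only [colorCard_eq_sum_compColorCard H, compColorCard_swapColors]
  rw [Finset.sum_comm]
  push_cast
  rw [Finset.mul_sum, ← Finset.sum_add_distrib]
  refine Finset.sum_congr rfl fun K hK => ?_
  have hsplit : ∀ j : Fin m,
      (compColorCard H c K (xor true (decide (j.val < n K))) : ℤ) =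
        compColorCard H c K true + if j.val < n K then
          (compColorCard H c K false : ℤ) - compColorCard H c K true else 0 := by
    intro j
    by_cases hj : j.val < n K <;> simp [hj]
  have hcount : (Finset.univ.filter fun j : Fin m => j.val < n K).card = n K := by
    rw [Fin.card_filter_val_lt, min_eq_right (hn K hK)]
  simp only [hsplit, Finset.sum_add_distrib, Finset.sum_const, Finset.card_univ,
    Fintype.card_fin, nsmul_eq_mul, ← Finset.sum_filter]
  rw [hcount]

/-- Lemma 3.6. Let `H` be a bipartite graph on `h` vertices with
`hcf_{χ,c}(H) = 1`, `u = σ(H) < w = h - u`, and let `β = max |βᵢ|` for integers `βᵢ` with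
`Σ βᵢ dᵢ = 1`. If `t = q(w-u) + r` with `0 ≤ r < w - u`, `m ≥ rβ + q` and `q ≥ rβ`, then
`K_{mu+t, mw-t}` contains an `H`-factor. -/
theorem statement_8 {α : Type*} [Fintype α] (H : SimpleGraph α) (h u w : ℕ)
    (hh : Fintype.card α = h) (c : α → Bool) (hc : Proper2Coloring H c)
    (hu : u = sigmaBip H) (hw : w = h - u) (huw : u < w)
    (hhcf : hcfChiC H c = 1)
    (b : H.ConnectedComponent → ℤ)
    (hb : (∑ K ∈ comps H, b K * (compDiff H c K : ℤ)) = 1)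
    (B : ℕ) (hB : B = (comps H).sup fun K => (b K).natAbs)
    (m q t r : ℕ) (ht : t = q * (w - u) + r) (hr : r < w - u)
    (h1 : r * B + q ≤ m) (h2 : r * B ≤ q) :
    HasHFactor H (completeBipartiteGraph (Fin (m * u + t)) (Fin (m * w - t))) := by
  obtain ⟨c', hc', hdiff⟩ := hc.exists_minority
  have hσ : colorCard c' true = u := by
    rw [hu, sigmaBip_eq_colorCard hc' fun K => by have := hdiff K; omega]
  have htot := colorCard_true_add_false c'
  have hsum : ∑ K ∈ comps H, (compDiff H c K : ℤ) = (w : ℤ) - u := by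
    have h₁ := colorCard_eq_sum_compColorCard H c' true
    have h₂ := colorCard_eq_sum_compColorCard H c' false
    have h₃ : ∑ K ∈ comps H, (compColorCard H c' K false : ℤ) =
        ∑ K ∈ comps H, (compColorCard H c' K true : ℤ) + ∑ K ∈ comps H, (compDiff H c K : ℤ) := by
      rw [← Finset.sum_add_distrib]
      exact Finset.sum_congr rfl fun K _ => hdiff K
    have h₄ : (colorCard c' false : ℤ) =
        colorCard c' true + ∑ K ∈ comps H, (compDiff H c K : ℤ) := by
      rw [h₁, h₂]
      push_cast
      exact h₃
    omega
  have hbound : ∀ K ∈ comps H, |(r : ℤ) * b K| ≤ r * B := by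
    intro K hK
    have hle : (b K).natAbs ≤ B := hB ▸ Finset.le_sup (f := fun K => (b K).natAbs) hK
    rw [abs_mul, Nat.abs_cast, Int.abs_eq_natAbs]
    gcongr
  zify at h1 h2
  have hn : ∀ K ∈ comps H, (((q : ℤ) + r * b K).toNat : ℤ) = q + r * b K := by
    intro K hK
    have := abs_le.1 (hbound K hK)
    exact Int.toNat_of_nonneg (by linarith)
  have hnm : ∀ K ∈ comps H, ((q : ℤ) + r * b K).toNat ≤ m := by
    intro K hK
    have := abs_le.1 (hbound K hK)
    zify
    rw [hn K hK]
    linarith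
  have htrue : ∑ j : Fin m, colorCard (swapColors H c' fun K =>
      decide (j.val < ((q : ℤ) + r * b K).toNat)) true = m * u + t := by
    zify [huw.le] at ht
    have hcount := sum_colorCard_swapColors H c' m _ hnm
    have hinc : ∑ K ∈ comps H, (((q : ℤ) + r * b K).toNat : ℤ) *
        ((compColorCard H c' K false : ℤ) - compColorCard H c' K true) =
        q * ∑ K ∈ comps H, (compDiff H c K : ℤ) +
          r * ∑ K ∈ comps H, b K * (compDiff H c K : ℤ) := by
      rw [Finset.mul_sum, Finset.mul_sum, ← Finset.sum_add_distrib]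
      refine Finset.sum_congr rfl fun K hK => ?_
      rw [hn K hK, hdiff K]
      ring
    rw [hinc, hsum, hb, hσ] at hcount
    rw [← Nat.cast_inj (R := ℤ), hcount]
    push_cast
    rw [ht]
    ring
  refine hasHFactor_of_colorings _ (fun j => hc'.swapColors _) htrue ?_
  have hall : ∑ j : Fin m, colorCard (swapColors H c' fun K =>
      decide (j.val < ((q : ℤ) + r * b K).toNat)) true + ∑ j : Fin m, colorCard
      (swapColors H c' fun K => decide (j.val < ((q : ℤ) + r * b K).toNat)) false = m * h := by
    rw [← Finset.sum_add_distrib]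
    simp [colorCard_true_add_false, hh]
  have hmh : m * h = m * u + m * w := by
    rw [← mul_add]
    congr 1
    omega
  omega

end BipTiling
end
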